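/- Let μ be a complex number and n ≥ 1 an integer. Then b_{2n+1}(1,0,μ) · (n+1)_n · (μ/2+n+1)_n = 2 · (μ/2+2n)_{n+1} · (μ+2n+1)_{n−1} · b_{2n}(1,0,μ). (Equivalently, when the denominators are nonzero, b_{2n+1}(1,0)/b_{2n}(1,0) = 2 (μ/2+2n)_{n+1} (μ+2n+1)_{n−1} / ( (n+1)_n (μ/2+n+1)_n ).) -/

import Mathlib

/-- Generalized binomial coefficient `C(x,k) = x(x-1)⋯(x-k+1)/k!` for complex `x`. -/
noncomputable def gbinom (x : ℂ) (k : ℕ) : ℂ :=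
  (∏ i ∈ Finset.range k, (x - i)) / (k.factorial : ℂ)

/-- Pochhammer symbol `(x)_k = x(x+1)⋯(x+k-1)`. -/
noncomputable def poch (x : ℂ) (k : ℕ) : ℂ :=
  ∏ i ∈ Finset.range k, (x + i)
/-- `b_n(I,J,μ)`: determinant of the `n×n` matrix with rows indexed by
`i = I,…,n-1+I`, columns indexed by `j = J,…,n-1+J`, and entries
`-δ_{i,j} + C(μ+i+j-2, j)`. -/
noncomputable def bdet (μ : ℂ) (n I J : ℕ) : ℂ :=
  Matrix.det (Matrix.of fun i j : Fin n =>
    (if I + i.1 = J + j.1 then (-1 : ℂ) else 0)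
      + gbinom (μ + ((I + i.1 : ℕ) : ℂ) + ((J + j.1 : ℕ) : ℂ) - 2) (J + j.1))

lemma gbinom_eq_choose (x : ℂ) (k : ℕ) : gbinom x k = Ring.choose x k := by
  rw [Ring.choose_eq_smul, ← Polynomial.aeval_eq_smeval, Polynomial.aeval_def,
    Polynomial.eval₂_eq_eval_map, descPochhammer_map, descPochhammer_eval_eq_prod_range,
    gbinom, smul_eq_mul]
  field_simp

lemma gbinom_zero (x : ℂ) : gbinom x 0 = 1 := by simp [gbinom]

lemma gbinom_succ (x : ℂ) (k : ℕ) :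
    gbinom x (k + 1) * (k + 1) = gbinom x k * (x - k) := by
  have : (k.factorial : ℂ) ≠ 0 := by exact_mod_cast k.factorial_ne_zero
  have h : (k + 1 : ℂ) ≠ 0 := by exact_mod_cast k.succ_ne_zero
  simp only [gbinom, Finset.prod_range_succ, Nat.factorial_succ]
  push_cast
  field_simp

lemma gbinom_add_one (x : ℂ) (k : ℕ) :
    gbinom (x + 1) (k + 1) = gbinom x k + gbinom x (k + 1) := by
  simp only [gbinom_eq_choose, Ring.choose_succ_succ]

lemma gbinom_add_one_mul (x : ℂ) (k : ℕ) :
    gbinom (x + 1) k * (x + 1 - k) = gbinom x k * (x + 1) := by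
  cases k with
  | zero => simp [gbinom_zero]
  | succ k =>
    have := gbinom_succ x k
    rw [gbinom_add_one]
    push_cast
    linear_combination -this

lemma gbinom_neg (x : ℂ) (k : ℕ) : gbinom (-x) k = (-1) ^ k * gbinom (x + k - 1) k := by
  simp only [gbinom_eq_choose, Ring.choose_neg]
  rw [Units.smul_def, ← Int.cast_negOnePow_natCast, zsmul_eq_mul]

lemma poch_zero (x : ℂ) : poch x 0 = 1 := by simp [poch]

lemma poch_succ (x : ℂ) (k : ℕ) : poch x (k + 1) = poch x k * (x + k) := by
  simp [poch, Finset.prod_range_succ]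

lemma poch_succ' (x : ℂ) (k : ℕ) : poch x (k + 1) = x * poch (x + 1) k := by
  simp only [poch, Finset.prod_range_succ']
  push_cast
  rw [mul_comm]
  congr 1
  · ring
  · exact Finset.prod_congr rfl fun i _ => by ring

lemma poch_add (x : ℂ) (k m : ℕ) : poch x (k + m) = poch x k * poch (x + k) m := by
  induction m with
  | zero => simp [poch_zero]
  | succ m ih => rw [← add_assoc, poch_succ, ih, poch_succ]; push_cast; ring

lemma gbinom_add_nat (x : ℂ) (k : ℕ) : gbinom (x + k - 1) k * k.factorial = poch x k := by
  induction k generalizing x with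
  | zero => simp [gbinom_zero, poch_zero]
  | succ k ih =>
    rw [poch_succ', ← ih (x + 1), Nat.factorial_succ]
    have h1 := gbinom_succ (x + k) k
    push_cast
    rw [show x + (k + 1) - 1 = x + k by ring, show x + 1 + k - 1 = x + k by ring]
    linear_combination (k.factorial : ℂ) * h1

/-- The power series `(1 - X) ^ a`. -/
noncomputable def powSeries (a : ℂ) : PowerSeries ℂ :=
  PowerSeries.rescale (-1 : ℂ) (PowerSeries.binomialSeries ℂ a)

lemma coeff_powSeries (a : ℂ) (k : ℕ) :
    PowerSeries.coeff k (powSeries a) = (-1) ^ k * gbinom a k := by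
  simp [powSeries, PowerSeries.coeff_rescale, gbinom_eq_choose]

lemma powSeries_add (a b : ℂ) : powSeries (a + b) = powSeries a * powSeries b := by
  simp [powSeries, PowerSeries.binomialSeries_add]

lemma powSeries_natCast (k : ℕ) : powSeries (k : ℂ) = (1 - PowerSeries.X) ^ k := by
  simp [powSeries, PowerSeries.binomialSeries_nat, sub_eq_add_neg, PowerSeries.rescale_X]

/-- The power series `(1 - X) ^ a * (1 - X / 2)`. -/
noncomputable def twistSeries (a : ℂ) : PowerSeries ℂ :=
  powSeries a * (1 - PowerSeries.C (1 / 2 : ℂ) * PowerSeries.X)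

lemma coeff_zero_twistSeries (a : ℂ) : PowerSeries.coeff 0 (twistSeries a) = 1 := by
  have := coeff_powSeries a 0
  simp only [PowerSeries.coeff_zero_eq_constantCoeff] at this ⊢
  simp [twistSeries, this, gbinom_zero]

lemma coeff_succ_twistSeries (a : ℂ) (k : ℕ) :
    PowerSeries.coeff (k + 1) (twistSeries a)
      = (-1) ^ (k + 1) * (gbinom a (k + 1) + gbinom a k / 2) := by
  rw [twistSeries, mul_sub, mul_one, ← mul_assoc, mul_comm (powSeries a), mul_assoc]
  simp only [map_sub, PowerSeries.coeff_C_mul, PowerSeries.coeff_succ_mul_X, coeff_powSeries]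
  ring

lemma twistSeries_add (a b : ℂ) : twistSeries (a + b) = powSeries a * twistSeries b := by
  simp [twistSeries, powSeries_add, mul_assoc]

lemma coeff_twistSeries_reflect (a : ℂ) (p : ℕ) :
    PowerSeries.coeff p (twistSeries (p - 2 - a))
      = (-1) ^ p * PowerSeries.coeff p (twistSeries a) := by
  cases p with
  | zero => simp only [coeff_zero_twistSeries, pow_zero, one_mul]
  | succ p =>
    rw [coeff_succ_twistSeries, coeff_succ_twistSeries]
    have h1 : gbinom ((p + 1 : ℕ) - 2 - a) (p + 1)
        = (-1) ^ (p + 1) * (gbinom a p + gbinom a (p + 1)) := by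
      rw [← gbinom_add_one, show ((p + 1 : ℕ) - 2 - a : ℂ) = -(a + 1 - p) by push_cast; ring,
        gbinom_neg]
      congr 2; push_cast; ring
    have h2 : gbinom ((p + 1 : ℕ) - 2 - a) p = (-1) ^ p * gbinom a p := by
      rw [show ((p + 1 : ℕ) - 2 - a : ℂ) = -(a + 1 - p) by push_cast; ring, gbinom_neg]
      congr 2; ring
    rw [h1, h2]
    ring

lemma coeff_twistSeries_mul (a : ℂ) (p : ℕ) :
    PowerSeries.coeff p (twistSeries a) * (2 * (a - p + 1))
      = (-1) ^ p * gbinom a p * (2 * a - p + 2) := by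
  cases p with
  | zero => rw [coeff_zero_twistSeries, gbinom_zero]; push_cast; ring
  | succ p =>
    rw [coeff_succ_twistSeries]
    have := gbinom_succ a p
    push_cast
    linear_combination (-1) ^ p * this

lemma coeff_twistSeries_step (a : ℂ) (p : ℕ) (h : a - p ≠ 0) :
    PowerSeries.coeff p (twistSeries (a + 1))
        * ((2 * a - p + 1) * (a - p + 1) * (a - p + 2))
      = -PowerSeries.coeff (p + 1) (twistSeries a) * ((p + 1) * (a + 1) * (2 * a - p + 4)) := by
  have h1 := coeff_twistSeries_mul (a + 1) p
  have h2 := coeff_twistSeries_mul a (p + 1)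
  have h3 := gbinom_succ a p
  have h4 := gbinom_add_one_mul a p
  refine mul_left_cancel₀ (mul_ne_zero two_ne_zero h) ?_
  push_cast at h1 h2
  linear_combination (a - p) * (2 * a - p + 1) * (a - p + 1) * h1
    + (p + 1) * (a + 1) * (2 * a - p + 4) * h2
    + (-1) ^ p * (a - p) * (2 * a - p + 1) * (2 * a - p + 4) * h4
    - (-1) ^ p * (2 * a - p + 1) * (a + 1) * (2 * a - p + 4) * h3

/-- Coefficients of `(1 - X) ^ i`. -/
noncomputable def subEntry (i j : ℕ) : ℂ := (-1) ^ j * (i.choose j : ℂ)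

/-- Diagonal weights conjugating the transpose of `subEntry` into `twistEntry`. -/
noncomputable def weight (μ : ℂ) (j : ℕ) : ℂ := poch (μ - 1) j / (j.factorial : ℂ)

/-- Coefficients of `(-X) ^ i * (1 - X) ^ (1 - μ - i)`. -/
noncomputable def twistEntry (μ : ℂ) (i j : ℕ) : ℂ :=
  weight μ j * subEntry j i / weight μ i

lemma subEntry_eq_zero {i j : ℕ} (h : i < j) : subEntry i j = 0 := by
  simp [subEntry, Nat.choose_eq_zero_of_lt h]

lemma twistEntry_eq_zero (μ : ℂ) {i j : ℕ} (h : j < i) : twistEntry μ i j = 0 := by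
  simp [twistEntry, subEntry_eq_zero h]

lemma linear_ne_zero {ν : ℂ} (hν : ν.im ≠ 0) (a : ℕ) (b : ℤ) (ha : a ≠ 0) :
    (a : ℂ) * ν + b ≠ 0 := by
  intro h
  have := congrArg Complex.im h
  simp [ha, hν] at this

lemma poch_ne_zero {ν : ℂ} (hν : ν.im ≠ 0) (k : ℕ) : poch ν k ≠ 0 := by
  refine Finset.prod_ne_zero_iff.2 fun i _ => ?_
  simpa using linear_ne_zero hν 1 i one_ne_zero

lemma weight_ne_zero {μ : ℂ} (hμ : μ.im ≠ 0) (j : ℕ) : weight μ j ≠ 0 :=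
  div_ne_zero (poch_ne_zero (by simpa using hμ) j) (by exact_mod_cast j.factorial_ne_zero)

lemma one_sub_pow_eq_sum (Y : Polynomial ℂ) {i N : ℕ} (h : i < N) :
    (1 - Y) ^ i = ∑ j ∈ Finset.range N, Polynomial.C (subEntry i j) * Y ^ j := by
  rw [sub_eq_neg_add, add_pow]
  refine (Finset.sum_subset (Finset.range_mono h) fun j _ hj => ?_).trans
    (Finset.sum_congr rfl fun j _ => ?_)
  · rw [Nat.choose_eq_zero_of_lt (by simpa using hj)]; simp
  · simp only [subEntry, map_mul, map_pow, map_neg, map_one, map_natCast, one_pow, mul_one]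
    rw [neg_pow]; ring

lemma coeff_one_sub_X_pow (i k : ℕ) :
    ((1 - Polynomial.X : Polynomial ℂ) ^ i).coeff k = subEntry i k := by
  rw [one_sub_pow_eq_sum _ (N := i + k + 1) (by lia)]
  simp [Polynomial.finsetSum_coeff, Polynomial.coeff_X_pow]

lemma sum_subEntry_mul_subEntry {i N : ℕ} (h : i < N) (k : ℕ) :
    ∑ j ∈ Finset.range N, subEntry i j * subEntry j k = if i = k then 1 else 0 := by
  have := congrArg (Polynomial.coeff · k) (one_sub_pow_eq_sum (1 - Polynomial.X) h)
  simp only [sub_sub_cancel, Polynomial.finsetSum_coeff, Polynomial.coeff_C_mul,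
    coeff_one_sub_X_pow, Polynomial.coeff_X_pow] at this
  rw [← this]
  simp [eq_comm]

lemma sum_twistEntry_mul_twistEntry {μ : ℂ} (hμ : μ.im ≠ 0) (i : ℕ) {k N : ℕ} (h : k < N) :
    ∑ j ∈ Finset.range N, twistEntry μ i j * twistEntry μ j k = if i = k then 1 else 0 := by
  have key : ∀ j, twistEntry μ i j * twistEntry μ j k
      = weight μ k / weight μ i * (subEntry k j * subEntry j i) := fun j => by
    have := weight_ne_zero hμ j
    simp only [twistEntry]; field_simp
  simp only [key, ← Finset.mul_sum, sum_subEntry_mul_subEntry h]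
  split_ifs with h1 h2 h2
  · rw [h1, mul_one, div_self (weight_ne_zero hμ i)]
  · exact absurd h1.symm h2
  · exact absurd h2.symm h1
  · simp

lemma twistEntry_add {μ : ℂ} (hμ : μ.im ≠ 0) (i p : ℕ) :
    twistEntry μ i (i + p) = (-1) ^ i * PowerSeries.coeff p (powSeries (1 - μ - i)) := by
  rw [coeff_powSeries, show 1 - μ - i = -(μ - 1 + i) by ring, gbinom_neg]
  have h1 := gbinom_add_nat (μ - 1 + i) p
  have h2 : ((i + p).choose i : ℂ) * i.factorial * p.factorial = (i + p).factorial := by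
    exact_mod_cast Nat.choose_symm_add (a := i) (b := p) ▸
      Nat.add_choose_mul_factorial_mul_factorial i p
  have h3 : ((-1 : ℂ) ^ p) * (-1) ^ p = 1 := by rw [← mul_pow]; simp
  have hi : (i.factorial : ℂ) ≠ 0 := by exact_mod_cast i.factorial_ne_zero
  have hp : (p.factorial : ℂ) ≠ 0 := by exact_mod_cast p.factorial_ne_zero
  have hip : ((i + p).factorial : ℂ) ≠ 0 := by exact_mod_cast (i + p).factorial_ne_zero
  have hw : poch (μ - 1) i ≠ 0 := poch_ne_zero (by simpa using hμ) i
  rw [← mul_assoc ((-1 : ℂ) ^ p), h3, one_mul]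
  simp only [twistEntry, weight, subEntry, poch_add, ← h1]
  field_simp
  linear_combination gbinom (μ - 1 + i + p - 1) p * h2

lemma twistEntry_of_le {μ : ℂ} (hμ : μ.im ≠ 0) {j k : ℕ} (h : j ≤ k) :
    twistEntry μ j k = (-1) ^ j * gbinom (μ + k - 2) (k - j) := by
  obtain ⟨p, rfl⟩ := Nat.exists_eq_add_of_le h
  rw [twistEntry_add hμ, coeff_powSeries, show 1 - μ - j = -(μ - 1 + j) by ring, gbinom_neg,
    ← mul_assoc ((-1 : ℂ) ^ p), ← mul_pow]
  simp only [mul_neg, mul_one, neg_neg, one_pow, one_mul, add_tsub_cancel_left]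
  congr 2; push_cast; ring

lemma sum_subEntry_mul_twistEntry {μ : ℂ} (hμ : μ.im ≠ 0) (i : ℕ) {k N : ℕ} (h : k < N) :
    ∑ j ∈ Finset.range N, subEntry i j * twistEntry μ j k = gbinom (μ + i + k - 2) k := by
  rw [gbinom_eq_choose, show μ + i + k - 2 = (i : ℂ) + (μ + k - 2) by ring,
    Ring.add_choose_eq _ (Commute.all _ _), Finset.Nat.sum_antidiagonal_eq_sum_range_succ_mk]
  refine ((Finset.sum_subset (Finset.range_mono h) fun j _ hj => ?_).symm).trans
    (Finset.sum_congr rfl fun j hj => ?_)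
  · rw [twistEntry_eq_zero μ (by simpa using hj), mul_zero]
  · rw [twistEntry_of_le hμ (by simpa [Nat.lt_succ_iff] using hj), subEntry,
      Ring.choose_natCast, ← gbinom_eq_choose]
    have h3 : ((-1 : ℂ) ^ j) * (-1) ^ j = 1 := by rw [← mul_pow]; simp
    linear_combination ((i.choose j : ℂ) * gbinom (μ + k - 2) (k - j)) * h3

/-- The difference of the involutions `subEntry` and `twistEntry`, restricted to the rows
`1, …, N` and the columns `0, …, N - 1`. -/
noncomputable def diffMatrix (μ : ℂ) (N : ℕ) : Matrix (Fin N) (Fin N) ℂ :=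
  Matrix.of fun i j => subEntry (1 + i) j - twistEntry μ (1 + i) j

lemma bdet_eq_det_diffMatrix {μ : ℂ} (hμ : μ.im ≠ 0) (N : ℕ) :
    bdet μ N 1 0 = (diffMatrix μ N).det * ∏ i ∈ Finset.range N, (-1) ^ i := by
  have hT : (Matrix.of fun i j : Fin N => twistEntry μ i j).det
      = ∏ i ∈ Finset.range N, (-1) ^ i := by
    rw [Matrix.det_of_isUpperTriangular, Finset.prod_range]
    · refine Finset.prod_congr rfl fun i _ => ?_
      have := weight_ne_zero hμ i
      simp only [Matrix.of_apply, twistEntry, subEntry, Nat.choose_self]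
      field_simp
      simp
    · intro i j hij
      exact twistEntry_eq_zero μ hij
  rw [← hT, ← Matrix.det_mul, bdet]
  congr 1
  ext i k
  simp only [Matrix.mul_apply, diffMatrix, Matrix.of_apply, sub_mul, Finset.sum_sub_distrib,
    zero_add]
  rw [← Finset.sum_range fun j => subEntry (1 + i) j * twistEntry μ j k,
    ← Finset.sum_range fun j => twistEntry μ (1 + i) j * twistEntry μ j k,
    sum_subEntry_mul_twistEntry hμ _ k.2, sum_twistEntry_mul_twistEntry hμ _ k.2]
  split_ifs <;> ring

lemma det_mul_last_of_mulVec {m : ℕ} (M : Matrix (Fin (m + 1)) (Fin (m + 1)) ℂ)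
    (c : Fin (m + 1) → ℂ) (h : ∀ i : Fin m, (M.mulVec c) i.castSucc = 0) :
    M.det * c (Fin.last m)
      = (M.submatrix Fin.castSucc Fin.castSucc).det * (M.mulVec c) (Fin.last m) := by
  have h1 := congrArg (fun A => (A.mulVec c) (Fin.last m)) (Matrix.adjugate_mul M)
  simp only [← Matrix.mulVec_mulVec, Matrix.smul_mulVec, Matrix.one_mulVec, Pi.smul_apply,
    smul_eq_mul] at h1
  rw [← h1, Matrix.mulVec, dotProduct, Fin.sum_univ_castSucc]
  simp only [h, mul_zero, Finset.sum_const_zero, zero_add]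
  rw [Matrix.adjugate_fin_succ_eq_det_submatrix]
  simp [Fin.succAbove_last, ← two_mul]

lemma bdet_ratio {μ : ℂ} (hμ : μ.im ≠ 0) (m : ℕ) (c : ℕ → ℂ)
    (h : ∀ i < m, ∑ j ∈ Finset.range (m + 1),
      (subEntry (1 + i) j - twistEntry μ (1 + i) j) * c j = 0) :
    bdet μ (m + 1) 1 0 * c m = (-1) ^ m * bdet μ m 1 0 *
      ∑ j ∈ Finset.range (m + 1), (subEntry (1 + m) j - twistEntry μ (1 + m) j) * c j := by
  have key : ∀ i : Fin (m + 1), (diffMatrix μ (m + 1)).mulVec (fun j => c j) i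
      = ∑ j ∈ Finset.range (m + 1), (subEntry (1 + i) j - twistEntry μ (1 + i) j) * c j := by
    intro i
    rw [Finset.sum_range]
    rfl
  have h1 := det_mul_last_of_mulVec (diffMatrix μ (m + 1)) (fun j => c j)
    (fun i => by rw [key]; exact h i i.2)
  have h2 : (diffMatrix μ (m + 1)).submatrix Fin.castSucc Fin.castSucc = diffMatrix μ m := rfl
  rw [h2, key] at h1
  rw [bdet_eq_det_diffMatrix hμ, bdet_eq_det_diffMatrix hμ, Finset.prod_range_succ]
  simp only [Fin.val_last] at h1
  linear_combination ((∏ i ∈ Finset.range m, (-1 : ℂ) ^ i) * (-1) ^ m) * h1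

/-- Column `m` of the triangular matrix diagonalising `twistEntry`. -/
noncomputable def eigenEntry (μ : ℂ) (i m : ℕ) : ℂ :=
  if i ≤ m then PowerSeries.coeff (m - i) (twistSeries ((μ + m - 3) / 2)) else 0

lemma sum_twistEntry_mul_eigenEntry {μ : ℂ} (hμ : μ.im ≠ 0) (i m : ℕ) :
    ∑ j ∈ Finset.range (m + 1), twistEntry μ i j * eigenEntry μ j m
      = (-1) ^ m * eigenEntry μ i m := by
  by_cases him : i ≤ m
  · obtain ⟨p, rfl⟩ := Nat.exists_eq_add_of_le him
    rw [add_assoc, Finset.sum_range_add, Finset.sum_eq_zero, zero_add]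
    · have h1 := coeff_twistSeries_reflect ((μ + (i + p : ℕ) - 3) / 2) p
      have h2 : (p - 2 - (μ + (i + p : ℕ) - 3) / 2 : ℂ)
          = (1 - μ - i) + (μ + (i + p : ℕ) - 3) / 2 := by push_cast; ring
      rw [h2, twistSeries_add, PowerSeries.coeff_mul,
        Finset.Nat.sum_antidiagonal_eq_sum_range_succ_mk] at h1
      simp only [eigenEntry, him, if_true, add_tsub_cancel_left]
      rw [pow_add, mul_assoc, ← h1, Finset.mul_sum]
      refine Finset.sum_congr rfl fun j hj => ?_
      have hj' : i + j ≤ i + p := by simpa [Nat.lt_succ_iff] using hj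
      rw [twistEntry_add hμ, if_pos hj', Nat.add_sub_add_left]
      ring
    · intro j hj
      rw [twistEntry_eq_zero μ (by simpa using hj), zero_mul]
  · rw [Finset.sum_eq_zero]
    · simp [eigenEntry, him]
    · intro j hj
      rw [twistEntry_eq_zero μ (by simp at hj; lia), zero_mul]

lemma sum_coeff_mul_subEntry {R : Polynomial ℂ} {M : ℕ} (hM : R.natDegree < M)
    (hR : R.comp (1 - Polynomial.X) = R) (j : ℕ) :
    ∑ i ∈ Finset.range M, R.coeff i * subEntry i j = R.coeff j := by
  conv_rhs => rw [← hR, Polynomial.comp, Polynomial.eval₂_eq_sum_range' _ hM]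
  simp [Polynomial.finsetSum_coeff, coeff_one_sub_X_pow]

lemma sum_coeff_mul_eigenEntry (μ : ℂ) (R : Polynomial ℂ) (m : ℕ) :
    ∑ i ∈ Finset.range (m + 1), R.coeff i * eigenEntry μ i m
      = PowerSeries.coeff m ((R : PowerSeries ℂ) * twistSeries ((μ + m - 3) / 2)) := by
  rw [PowerSeries.coeff_mul, Finset.Nat.sum_antidiagonal_eq_sum_range_succ_mk]
  refine Finset.sum_congr rfl fun i hi => ?_
  rw [eigenEntry, if_pos (by simpa [Nat.lt_succ_iff] using hi), Polynomial.coeff_coe]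

lemma sum_coeff_mul_eigenEntry' (μ : ℂ) {R : Polynomial ℂ} {M : ℕ} (hM : R.natDegree < M)
    (m : ℕ) :
    ∑ i ∈ Finset.range M, R.coeff i * eigenEntry μ i m
      = PowerSeries.coeff m ((R : PowerSeries ℂ) * twistSeries ((μ + m - 3) / 2)) := by
  rw [← sum_coeff_mul_eigenEntry]
  have h1 : ∀ K, M ≤ K → ∑ i ∈ Finset.range M, R.coeff i * eigenEntry μ i m
      = ∑ i ∈ Finset.range K, R.coeff i * eigenEntry μ i m := fun K hK =>
    Finset.sum_subset (Finset.range_mono hK) fun i _ hi => by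
      rw [Polynomial.coeff_eq_zero_of_natDegree_lt (by simp at hi; lia), zero_mul]
  have h2 : ∀ K, m + 1 ≤ K → ∑ i ∈ Finset.range (m + 1), R.coeff i * eigenEntry μ i m
      = ∑ i ∈ Finset.range K, R.coeff i * eigenEntry μ i m := fun K hK =>
    Finset.sum_subset (Finset.range_mono hK) fun i _ hi => by
      rw [eigenEntry, if_neg (by simp at hi; lia), mul_zero]
  rw [h1 (M + m + 1) (by lia), h2 (M + m + 1) (by lia)]

/-- The `j`-th coefficient of the difference between a polynomial and its twist. -/
noncomputable def defect (μ : ℂ) (R : Polynomial ℂ) (M j : ℕ) : ℂ :=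
  ∑ i ∈ Finset.range M, R.coeff i * twistEntry μ i j - R.coeff j

lemma sum_defect_mul_eigenEntry {μ : ℂ} (hμ : μ.im ≠ 0) {R : Polynomial ℂ} {M : ℕ}
    (hM : R.natDegree < M) (m : ℕ) :
    ∑ j ∈ Finset.range (m + 1), defect μ R M j * eigenEntry μ j m
      = ((-1) ^ m - 1) *
        PowerSeries.coeff m ((R : PowerSeries ℂ) * twistSeries ((μ + m - 3) / 2)) := by
  simp only [defect, sub_mul, Finset.sum_sub_distrib, sum_coeff_mul_eigenEntry, Finset.sum_mul,
    one_mul]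
  rw [Finset.sum_comm]
  simp only [mul_assoc, ← Finset.mul_sum, sum_twistEntry_mul_eigenEntry hμ]
  rw [← sum_coeff_mul_eigenEntry' μ hM, Finset.mul_sum]
  congr 1
  exact Finset.sum_congr rfl fun i _ => by ring

lemma eigenEntry_self (μ : ℂ) (m : ℕ) : eigenEntry μ m m = 1 := by
  simp only [eigenEntry, le_refl, if_true, Nat.sub_self, coeff_zero_twistSeries]

lemma defect_eq {μ : ℂ} (hμ : μ.im ≠ 0) {R : Polynomial ℂ} {M : ℕ} (hM : R.natDegree < M)
    (m : ℕ) (h : ∀ j < m, defect μ R M j = 0) :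
    defect μ R M m = ((-1) ^ m - 1) *
      PowerSeries.coeff m ((R : PowerSeries ℂ) * twistSeries ((μ + m - 3) / 2)) := by
  rw [← sum_defect_mul_eigenEntry hμ hM, Finset.sum_range_succ, Finset.sum_eq_zero,
    eigenEntry_self, zero_add, mul_one]
  intro j hj
  rw [h j (by simpa using hj), zero_mul]

lemma sum_diff_mul_coeff_div_weight {μ : ℂ} (hμ : μ.im ≠ 0) {R : Polynomial ℂ} {M : ℕ}
    (hM : R.natDegree < M) (hR : R.comp (1 - Polynomial.X) = R) (i : ℕ) :
    ∑ j ∈ Finset.range M, (subEntry i j - twistEntry μ i j) * (R.coeff j / weight μ j)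
      = defect μ R M i / weight μ i := by
  rw [defect, ← sum_coeff_mul_subEntry hM hR i, ← Finset.sum_sub_distrib, Finset.sum_div]
  refine Finset.sum_congr rfl fun j _ => ?_
  have h1 := weight_ne_zero hμ i
  have h2 := weight_ne_zero hμ j
  simp only [twistEntry]
  field_simp

lemma bdet_ratio_of_symmetric {μ : ℂ} (hμ : μ.im ≠ 0) {R : Polynomial ℂ} {n : ℕ}
    (hM : R.natDegree < 2 * n + 1) (hR : R.comp (1 - Polynomial.X) = R)
    (h : ∀ l < n, PowerSeries.coeff (2 * l + 1)
      ((R : PowerSeries ℂ) * twistSeries ((μ + (2 * l + 1 : ℕ) - 3) / 2)) = 0) :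
    bdet μ (2 * n + 1) 1 0 * (R.coeff (2 * n) / weight μ (2 * n))
      = bdet μ (2 * n) 1 0 * (-2 * PowerSeries.coeff (2 * n + 1)
      ((R : PowerSeries ℂ) * twistSeries ((μ + (2 * n + 1 : ℕ) - 3) / 2))
        / weight μ (2 * n + 1)) := by
  have hd : ∀ j < 2 * n + 1, defect μ R (2 * n + 1) j = 0 := by
    intro j
    induction j using Nat.strong_induction_on with
    | _ j ih =>
      intro hj
      rw [defect_eq hμ hM j fun i hi => ih i hi (hi.trans hj)]
      rcases Nat.even_or_odd' j with ⟨l, rfl | rfl⟩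
      · simp
      · rw [h l (by lia), mul_zero]
  rw [bdet_ratio hμ (2 * n) (fun j => R.coeff j / weight μ j) fun i hi => by
    rw [sum_diff_mul_coeff_div_weight hμ hM hR, hd _ (by lia), zero_div]]
  rw [sum_diff_mul_coeff_div_weight hμ hM hR, add_comm 1 (2 * n), defect_eq hμ hM _ hd]
  simp only [pow_succ, pow_mul]
  norm_num

/-- Coefficients of the hypergeometric polynomial
`₃F₂(-n, ν - 1/2, ν + n; -2 * n, 2 * ν + 2 * n; 4 * t)`. -/
noncomputable def hyperCoeff (ν : ℂ) (n k : ℕ) : ℂ :=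
  ∏ i ∈ Finset.range k, ((n - i) * (2 * ν + 2 * i - 1) * (2 * ν + 2 * n + 2 * i)
    / ((i + 1) * (2 * n - i) * (2 * ν + 2 * n + i)))

/-- The coefficient of `X ^ (2 * l + 1)` in
`X ^ k * (1 - X) ^ (ν + k + l - 1) * (1 - X / 2)`. -/
noncomputable def oddCoeff (ν : ℂ) (l k : ℕ) : ℂ :=
  if k ≤ 2 * l + 1 then PowerSeries.coeff (2 * l + 1 - k) (twistSeries (ν + k + l - 1)) else 0

/-- The polynomial `∑ k, hyperCoeff ν n k * (X * (1 - X)) ^ k`. -/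
noncomputable def hyperPoly (ν : ℂ) (n : ℕ) : Polynomial ℂ :=
  ∑ k ∈ Finset.range (n + 1),
    Polynomial.C (hyperCoeff ν n k) * (Polynomial.X * (1 - Polynomial.X)) ^ k

/-- The eigencoordinate of `hyperPoly ν n` of index `2 * l + 1`. -/
noncomputable def oddSum (ν : ℂ) (n l : ℕ) : ℂ :=
  ∑ k ∈ Finset.range (n + 1), hyperCoeff ν n k * oddCoeff ν l k

lemma hyperPoly_comp (ν : ℂ) (n : ℕ) :
    (hyperPoly ν n).comp (1 - Polynomial.X) = hyperPoly ν n := by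
  simp only [hyperPoly, Polynomial.sum_comp, Polynomial.mul_comp, Polynomial.C_comp,
    Polynomial.pow_comp, Polynomial.X_comp, Polynomial.sub_comp, Polynomial.one_comp]
  refine Finset.sum_congr rfl fun k _ => ?_
  ring

lemma coeff_hyperPoly (ν : ℂ) (n j : ℕ) :
    (hyperPoly ν n).coeff j = ∑ k ∈ Finset.range (n + 1),
      hyperCoeff ν n k * if k ≤ j then subEntry k (j - k) else 0 := by
  simp only [hyperPoly, Polynomial.finsetSum_coeff, Polynomial.coeff_C_mul, mul_pow,
    Polynomial.coeff_X_pow_mul', coeff_one_sub_X_pow]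

lemma natDegree_hyperPoly (ν : ℂ) (n : ℕ) : (hyperPoly ν n).natDegree < 2 * n + 1 := by
  rw [Nat.lt_succ_iff, Polynomial.natDegree_le_iff_coeff_eq_zero]
  intro j hj
  rw [coeff_hyperPoly]
  refine Finset.sum_eq_zero fun k hk => ?_
  rw [Finset.mem_range] at hk
  rw [subEntry_eq_zero (by lia), ite_self, mul_zero]

lemma coeff_hyperPoly_top (ν : ℂ) (n : ℕ) :
    (hyperPoly ν n).coeff (2 * n) = (-1) ^ n * hyperCoeff ν n n := by
  rw [coeff_hyperPoly, Finset.sum_range_succ, Finset.sum_eq_zero]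
  · rw [if_pos (by lia), show 2 * n - n = n by lia, subEntry, Nat.choose_self]
    push_cast; ring
  · intro k hk
    rw [Finset.mem_range] at hk
    rw [subEntry_eq_zero (by lia), ite_self, mul_zero]

lemma coeff_hyperPoly_mul_twistSeries (ν : ℂ) (n l : ℕ) :
    PowerSeries.coeff (2 * l + 1) ((hyperPoly ν n : PowerSeries ℂ)
      * twistSeries ((2 * ν + (2 * l + 1 : ℕ) - 3) / 2)) = oddSum ν n l := by
  have hcast : (hyperPoly ν n : PowerSeries ℂ) = ∑ k ∈ Finset.range (n + 1),
      PowerSeries.C (hyperCoeff ν n k) * (PowerSeries.X * (1 - PowerSeries.X)) ^ k := by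
    rw [hyperPoly, ← Polynomial.coeToPowerSeries.ringHom_apply, map_sum]
    simp
  rw [hcast, Finset.sum_mul, map_sum, oddSum]
  refine Finset.sum_congr rfl fun k _ => ?_
  rw [mul_assoc, PowerSeries.coeff_C_mul, mul_pow, ← powSeries_natCast, mul_assoc,
    ← twistSeries_add, PowerSeries.coeff_X_pow_mul', oddCoeff]
  congr 4
  push_cast; ring

lemma hyperCoeff_succ (ν : ℂ) (n k : ℕ) :
    hyperCoeff ν n (k + 1) = hyperCoeff ν n k *
      ((n - k) * (2 * ν + 2 * k - 1) * (2 * ν + 2 * n + 2 * k)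
        / ((k + 1) * (2 * n - k) * (2 * ν + 2 * n + k))) :=
  Finset.prod_range_succ _ _

lemma hyperCoeff_zero (ν : ℂ) (n : ℕ) : hyperCoeff ν n 0 = 1 := by simp [hyperCoeff]

lemma hyperCoeff_self_succ (ν : ℂ) (n : ℕ) : hyperCoeff ν n (n + 1) = 0 := by
  simp [hyperCoeff_succ]

lemma natCast_sub_ne_zero {a b : ℕ} (h : b < a) : (a : ℂ) - b ≠ 0 := by
  rw [sub_ne_zero]
  exact_mod_cast h.ne'

lemma hyperCoeff_succ_mul {ν : ℂ} (hν : ν.im ≠ 0) {n k : ℕ} (hk : k ≤ n) :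
    hyperCoeff ν n (k + 1) * ((k + 1) * (2 * n - k) * (2 * ν + 2 * n + k)) =
      hyperCoeff ν n k * ((n - k) * (2 * ν + 2 * k - 1) * (2 * ν + 2 * n + 2 * k)) := by
  rcases hk.eq_or_lt with rfl | hk
  · simp [hyperCoeff_self_succ]
  have h1 : (2 * n : ℂ) - k ≠ 0 := by
    simpa using natCast_sub_ne_zero (show k < 2 * n by lia)
  have h4 : (k + 1 : ℂ) ≠ 0 := by exact_mod_cast k.succ_ne_zero
  have h5 : 2 * ν + 2 * n + k ≠ 0 := by
    convert linear_ne_zero hν 2 (2 * n + k) two_ne_zero using 1; push_cast; ring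
  rw [hyperCoeff_succ, mul_assoc, div_mul_cancel₀ _ (mul_ne_zero (mul_ne_zero h4 h1) h5)]

lemma hyperCoeff_eq_hyperCoeff_succ {ν : ℂ} (hν : ν.im ≠ 0) {n k : ℕ} (hk : k ≤ n) :
    hyperCoeff ν n k * ((ν + n + k) * (2 * n + 2 - k) * (2 * n + 1 - k) * (2 * ν + 2 * n + 1))
      = hyperCoeff ν (n + 1) k *
        ((n + 1 - k) * (2 * n + 1) * (2 * ν + 2 * n + k) * (2 * ν + 2 * n + k + 1)) := by
  induction k with
  | zero => simp only [hyperCoeff_zero]; push_cast; ring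
  | succ k ih =>
    have ih := ih (by lia)
    have A := hyperCoeff_succ_mul hν (show k ≤ n by lia)
    have B := hyperCoeff_succ_mul hν (show k ≤ n + 1 by lia)
    have h1 : (2 * n : ℂ) - k ≠ 0 := by
      simpa using natCast_sub_ne_zero (show k < 2 * n by lia)
    have h2 : (2 * n + 2 : ℂ) - k ≠ 0 := by
      simpa using natCast_sub_ne_zero (show k < 2 * n + 2 by lia)
    have h3 : (2 * n + 1 : ℂ) - k ≠ 0 := by
      simpa using natCast_sub_ne_zero (show k < 2 * n + 1 by lia)
    have h4 : (k + 1 : ℂ) ≠ 0 := by exact_mod_cast k.succ_ne_zero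
    have h5 : 2 * ν + 2 * n + k ≠ 0 := by
      convert linear_ne_zero hν 2 (2 * n + k) two_ne_zero using 1; push_cast; ring
    have h8 : ν + n + k ≠ 0 := by
      convert linear_ne_zero hν 1 (n + k) one_ne_zero using 1; push_cast; ring
    have h6 : 2 * ν + 2 * n + k + 2 ≠ 0 := by
      convert linear_ne_zero hν 2 (2 * n + k + 2) two_ne_zero using 1; push_cast; ring
    refine mul_right_cancel₀ (mul_ne_zero (mul_ne_zero (mul_ne_zero (mul_ne_zero h4 h2) h5) h8)
      h6) ?_
    push_cast at A B ⊢
    generalize hyperCoeff ν n k = q at *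
    generalize hyperCoeff ν (n + 1) k = q₁ at *
    generalize hyperCoeff ν n (k + 1) = q₂ at *
    generalize hyperCoeff ν (n + 1) (k + 1) = q₃ at *
    linear_combination
      (ν + n + k) * (ν + n + k + 1) * (2 * n + 1 - k) * (2 * ν + 2 * n + 1) * (2 * n + 2 - k)
        * (2 * ν + 2 * n + k + 2) * A
      + 2 * (n - k) * (2 * ν + 2 * k - 1) * (ν + n + k) * (ν + n + k + 1)
        * (2 * ν + 2 * n + k + 2) * ih
      - (n - k) * (2 * n + 1) * (2 * ν + 2 * n + k + 1) * (2 * ν + 2 * n + k + 2)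
        * (ν + n + k) * (2 * ν + 2 * n + k) * B

lemma oddCoeff_step {ν : ℂ} (hν : ν.im ≠ 0) (l k : ℕ) :
    oddCoeff ν l (k + 1) * ((3 * k + 2 * ν - 1) * (ν + 2 * k - l) * (ν + 2 * k - l + 1))
      = -oddCoeff ν l k * ((3 * k + 2 * ν + 2) * (ν + k + l) * (2 * l + 1 - k)) := by
  rcases lt_trichotomy k (2 * l + 1) with hk | hk | hk
  · obtain ⟨p, hp⟩ := Nat.exists_eq_add_of_lt hk
    have hpc : (p : ℂ) = 2 * l - k := by
      have : (2 * l + 1 : ℂ) = k + p + 1 := by exact_mod_cast hp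
      linear_combination -this
    have hne : (ν + k + l - 1) - (p : ℂ) ≠ 0 := by
      rw [hpc]
      convert linear_ne_zero hν 1 (2 * k - l - 1) one_ne_zero using 1; push_cast; ring
    have := coeff_twistSeries_step (ν + k + l - 1) p hne
    rw [oddCoeff, oddCoeff, if_pos (by lia), if_pos (by lia),
      show 2 * l + 1 - (k + 1) = p by lia, show 2 * l + 1 - k = p + 1 by lia,
      show ν + (k + 1 : ℕ) + l - 1 = ν + k + l - 1 + 1 by push_cast; ring]
    rw [hpc] at this
    linear_combination this
  · subst hk
    rw [oddCoeff, if_neg (by lia)]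
    push_cast; ring
  · rw [oddCoeff, if_neg (by lia), oddCoeff, if_neg (by lia)]
    ring

lemma partial_oddSum_step (ν n l K : ℂ) :
    -((2 * n + 1 - K) * (ν + 2 * n + 1) * (ν + l + K) * K * (ν + 2 * K - l - 2)
        * (ν + 2 * K - l - 1) * (2 * ν + 2 * n + K + 1))
      + (ν + l + n + 1) * (ν - l + 2 * n) * (ν - l + 2 * n + 1) * (3 * K + 2 * ν - 1)
        * (ν + n + K) * (2 * n + 2 - K) * (2 * n + 1 - K)
      + (l - n) * (ν + l + 2 * n + 1) * (ν + l + 2 * n + 2) * (3 * K + 2 * ν - 1)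
        * (n + 1 - K) * (2 * ν + 2 * n + K) * (2 * ν + 2 * n + K + 1)
    = 2 * (ν + 2 * n + 1) * (ν + l + K + 1) * (ν + n + K) * (n + 1 - K) * (2 * ν + 2 * K - 1)
        * (ν + l + K) * (2 * l + 1 - K) := by
  ring

lemma partial_oddSum {ν : ℂ} (hν : ν.im ≠ 0) (n l K : ℕ) (hK : K ≤ n + 1) :
    (∑ k ∈ Finset.range K,
      ((2 * n + 1) * (ν + l + n + 1) * (ν - l + 2 * n) * (ν - l + 2 * n + 1)
          * hyperCoeff ν (n + 1) k
        + (l - n) * (2 * ν + 2 * n + 1) * (ν + l + 2 * n + 1) * (ν + l + 2 * n + 2)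
          * hyperCoeff ν n k) * oddCoeff ν l k)
      * ((3 * K + 2 * ν - 1) * (ν + n + K) * (2 * n + 2 - K))
    = -((2 * n + 1) * (ν + 2 * n + 1) * (ν + l + K) * K * (ν + 2 * K - l - 2)
        * (ν + 2 * K - l - 1) * (2 * ν + 2 * n + K + 1))
        * hyperCoeff ν (n + 1) K * oddCoeff ν l K := by
  induction K with
  | zero => simp
  | succ K ih =>
    replace ih := ih (by lia)
    rw [Finset.sum_range_succ]
    generalize (∑ k ∈ Finset.range K, (_ : ℂ)) = s at ih ⊢
    have h2 : (2 * n + 2 : ℂ) - K ≠ 0 := by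
      simpa using natCast_sub_ne_zero (show K < 2 * n + 2 by lia)
    have h8 : ν + n + K ≠ 0 := by
      convert linear_ne_zero hν 1 (n + K) one_ne_zero using 1; push_cast; ring
    have h10 : 3 * K + 2 * ν - 1 ≠ 0 := by
      convert linear_ne_zero hν 2 (3 * K - 1) two_ne_zero using 1; push_cast; ring
    have e1 := hyperCoeff_eq_hyperCoeff_succ hν (show K ≤ n by lia)
    have e2 := oddCoeff_step hν l K
    have e3 := hyperCoeff_succ_mul hν (show K ≤ n + 1 by lia)
    have key := partial_oddSum_step ν n l K
    refine mul_right_cancel₀ (mul_ne_zero (mul_ne_zero h10 h8) h2) ?_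
    push_cast at e3 ⊢
    rw [show 3 * (K + 1 : ℂ) + 2 * ν - 1 = 3 * K + 2 * ν + 2 by ring,
      show ν + n + (K + 1 : ℂ) = ν + n + K + 1 by ring,
      show (2 * n + 2 : ℂ) - (K + 1) = 2 * n + 1 - K by ring,
      show ν + l + (K + 1 : ℂ) = ν + l + K + 1 by ring,
      show ν + 2 * (K + 1 : ℂ) - l - 2 = ν + 2 * K - l by ring,
      show ν + 2 * (K + 1 : ℂ) - l - 1 = ν + 2 * K - l + 1 by ring,
      show 2 * ν + 2 * n + (K + 1 : ℂ) + 1 = 2 * ν + 2 * n + K + 2 by ring]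
    rw [show 2 * (n + 1 : ℂ) - K = 2 * n + 2 - K by ring,
      show 2 * ν + 2 * (n + 1 : ℂ) + K = 2 * ν + 2 * n + K + 2 by ring,
      show 2 * ν + 2 * (n + 1 : ℂ) + 2 * K = 2 * (ν + n + K + 1) by ring] at e3
    rw [add_right_comm ν (K : ℂ)] at e2
    clear h2 h8 h10
    generalize hyperCoeff ν (n + 1) K = q at *
    generalize hyperCoeff ν (n + 1) (K + 1) = q₁ at *
    generalize hyperCoeff ν n K = r at *
    generalize oddCoeff ν l K = w at *
    generalize oddCoeff ν l (K + 1) = w₁ at *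
    generalize (3 * K + 2 * ν + 2 : ℂ) = f₁ at *
    generalize (3 * K + 2 * ν - 1 : ℂ) = f₂ at *
    generalize (ν + n + K + 1 : ℂ) = f₃ at *
    generalize (ν + n + K : ℂ) = f₄ at *
    generalize (2 * n + 1 - K : ℂ) = f₅ at *
    generalize (2 * n + 2 - K : ℂ) = f₆ at *
    generalize (2 * ν + 2 * n + K + 2 : ℂ) = f₇ at *
    generalize (2 * ν + 2 * n + K + 1 : ℂ) = f₈ at *
    generalize (2 * ν + 2 * n + K : ℂ) = f₉ at *
    generalize (ν + 2 * K - l + 1 : ℂ) = g₁ at *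
    generalize (ν + 2 * K - l - 1 : ℂ) = g₂ at *
    generalize (ν + 2 * K - l - 2 : ℂ) = g₃ at *
    generalize (ν + 2 * K - l : ℂ) = g₄ at *
    generalize (ν + l + K + 1 : ℂ) = g₅ at *
    generalize (ν + l + K : ℂ) = g₆ at *
    generalize (2 * ν + 2 * n + 1 : ℂ) = g₇ at *
    generalize (2 * n + 1 : ℂ) = g₈ at *
    generalize (n + 1 - K : ℂ) = g₉ at *
    generalize (ν + l + n + 1 : ℂ) = k₁ at *
    generalize (ν - l + 2 * n + 1 : ℂ) = k₂ at *
    generalize (ν - l + 2 * n : ℂ) = k₃ at *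
    generalize (ν + l + 2 * n + 1 : ℂ) = k₄ at *
    generalize (ν + l + 2 * n + 2 : ℂ) = k₅ at *
    generalize (l - n : ℂ) = k₆ at *
    generalize (ν + 2 * n + 1 : ℂ) = k₇ at *
    generalize (2 * ν + 2 * K - 1 : ℂ) = k₈ at *
    generalize (2 * l + 1 - K : ℂ) = k₉ at *
    linear_combination (f₁ * f₃ * f₅) * ih + (k₆ * k₄ * k₅ * w * f₁ * f₃ * f₂) * e1
      + (f₁ * f₃ * q * w * g₈) * key
      + (g₈ * k₇ * g₅ * f₄ * w₁ * f₂ * g₄ * g₁) * e3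
      + (g₈ * k₇ * g₅ * f₄ * q * g₉ * k₈ * 2 * f₃) * e2

lemma oddSum_succ {ν : ℂ} (hν : ν.im ≠ 0) (n l : ℕ) :
    oddSum ν (n + 1) l
        * ((2 * n + 1) * (ν + l + n + 1) * (ν - l + 2 * n) * (ν - l + 2 * n + 1))
      = -oddSum ν n l
        * ((l - n) * (2 * ν + 2 * n + 1) * (ν + l + 2 * n + 1) * (ν + l + 2 * n + 2)) := by
  have h := partial_oddSum hν n l (n + 1) le_rfl
  have h1 : 3 * ((n + 1 : ℕ) : ℂ) + 2 * ν - 1 ≠ 0 := by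
    convert linear_ne_zero hν 2 (3 * n + 2) two_ne_zero using 1; push_cast; ring
  have h2 : ν + n + (n + 1 : ℕ) ≠ 0 := by
    convert linear_ne_zero hν 1 (2 * n + 1) one_ne_zero using 1; push_cast; ring
  have h3 : (2 * n + 2 : ℂ) - (n + 1 : ℕ) ≠ 0 := by
    simpa using natCast_sub_ne_zero (show n + 1 < 2 * n + 2 by lia)
  rw [oddSum, oddSum, Finset.sum_range_succ]
  simp only [add_mul, Finset.sum_add_distrib, mul_assoc _ (hyperCoeff ν _ _), ← Finset.mul_sum]
    at h
  refine mul_right_cancel₀ (mul_ne_zero (mul_ne_zero h1 h2) h3) ?_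
  push_cast at h ⊢
  linear_combination h
lemma oddSum_succ_factor_ne_zero {ν : ℂ} (hν : ν.im ≠ 0) (n l : ℕ) :
    (2 * n + 1) * (ν + l + n + 1) * (ν - l + 2 * n) * (ν - l + 2 * n + 1) ≠ 0 := by
  have h1 : (2 * n + 1 : ℂ) ≠ 0 := by exact_mod_cast (2 * n).succ_ne_zero
  have h2 : ν + l + n + 1 ≠ 0 := by
    convert linear_ne_zero hν 1 (l + n + 1) one_ne_zero using 1; push_cast; ring
  have h3 : ν - l + 2 * n ≠ 0 := by
    convert linear_ne_zero hν 1 (2 * n - l) one_ne_zero using 1; push_cast; ring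
  have h4 : ν - l + 2 * n + 1 ≠ 0 := by
    convert linear_ne_zero hν 1 (2 * n - l + 1) one_ne_zero using 1; push_cast; ring
  exact mul_ne_zero (mul_ne_zero (mul_ne_zero h1 h2) h3) h4

lemma oddSum_eq_zero {ν : ℂ} (hν : ν.im ≠ 0) {n l : ℕ} (hl : l < n) : oddSum ν n l = 0 := by
  induction n with
  | zero => lia
  | succ n ih =>
    refine (mul_eq_zero.1 ?_).resolve_right (oddSum_succ_factor_ne_zero hν n l)
    rw [oddSum_succ hν]
    rcases (Nat.lt_succ_iff.1 hl).eq_or_lt with rfl | h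
    · simp
    · simp [ih h]

lemma oddSum_zero {ν : ℂ} (hν : ν.im ≠ 0) (l : ℕ) :
    oddSum ν 0 l * (2 * (2 * l + 1) * (2 * l).factorial)
      = -(2 * ν - 1) * poch (ν - l) (2 * l) := by
  have h1 : ν - l - 1 ≠ 0 := by
    convert linear_ne_zero hν 1 (-l - 1) one_ne_zero using 1; push_cast; ring
  have hs : oddSum ν 0 l = PowerSeries.coeff (2 * l + 1) (twistSeries (ν + l - 1)) := by
    simp [oddSum, oddCoeff, hyperCoeff_zero]
  have h := coeff_twistSeries_mul (ν + l - 1) (2 * l + 1)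
  have h2 := gbinom_succ (ν + l - 1) (2 * l)
  have h3 := gbinom_add_nat (ν - l) (2 * l)
  rw [show ν - l + (2 * l : ℕ) - 1 = ν + l - 1 by push_cast; ring] at h3
  rw [← hs, Odd.neg_one_pow ⟨l, rfl⟩] at h
  push_cast at h h2
  refine mul_right_cancel₀ h1 ?_
  linear_combination (2 * l + 1) * (2 * l).factorial * h
    - (2 * ν - 1) * (2 * l).factorial * h2 - (2 * ν - 1) * (ν - l - 1) * h3

lemma oddSum_mul {ν : ℂ} (hν : ν.im ≠ 0) (n l : ℕ) :
    oddSum ν n l * ((2 * n).factorial * poch (ν + l + 1) n * poch (ν - l) (2 * n))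
      = oddSum ν 0 l * ((-1) ^ n * l.descFactorial n * n.factorial * 4 ^ n * poch (ν + 1 / 2) n
        * poch (ν + l + 1) (2 * n)) := by
  induction n with
  | zero => simp [poch_zero]
  | succ n ih =>
    have h := oddSum_succ hν n l
    have hd : (l.descFactorial (n + 1) : ℂ) = (l - n) * l.descFactorial n := by
      rw [Nat.descFactorial_succ]
      rcases le_or_gt n l with hnl | hnl
      · push_cast [hnl]; ring
      · simp [Nat.descFactorial_of_lt hnl]
    rw [show 2 * (n + 1) = 2 * n + 1 + 1 by ring, Nat.factorial_succ, Nat.factorial_succ,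
      Nat.factorial_succ, poch_succ, poch_succ, poch_succ, poch_succ, poch_succ, poch_succ, hd]
    push_cast
    generalize poch (ν + l + 1) (2 * n) = p₁ at *
    generalize poch (ν + l + 1) n = p₂ at *
    generalize poch (ν - l) (2 * n) = p₃ at *
    generalize poch (ν + 1 / 2) n = p₄ at *
    generalize oddSum ν (n + 1) l = s at *
    linear_combination (2 * (n + 1) * (2 * n).factorial * p₂ * p₃) * h
      - (2 * (n + 1) * (l - n) * (2 * ν + 2 * n + 1) * (ν + l + 2 * n + 1)
        * (ν + l + 2 * n + 2)) * ih

lemma oddSum_self {ν : ℂ} (hν : ν.im ≠ 0) (n : ℕ) :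
    oddSum ν n n * ((2 * n).factorial * (2 * n).factorial * (2 * (2 * n + 1)))
      = -(2 * ν - 1) * (-1) ^ n * n.factorial * n.factorial * 4 ^ n * poch (ν + 1 / 2) n
        * poch (ν + 2 * n + 1) n := by
  have h := oddSum_mul hν n n
  have h0 := oddSum_zero hν n
  rw [Nat.descFactorial_self, two_mul n, poch_add (ν + n + 1), ← two_mul n] at h
  rw [show ν + n + 1 + n = ν + 2 * n + 1 by ring] at h
  have h1 : poch (ν + n + 1) n ≠ 0 := poch_ne_zero (by simpa using hν) n
  have h2 : poch (ν - n) (2 * n) ≠ 0 := poch_ne_zero (by simpa using hν) _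
  refine mul_right_cancel₀ (mul_ne_zero h1 h2) ?_
  linear_combination (2 * (2 * n + 1) * (2 * n).factorial) * h
    + ((-1) ^ n * n.factorial * n.factorial * 4 ^ n * poch (ν + 1 / 2) n * poch (ν + n + 1) n
      * poch (ν + 2 * n + 1) n) * h0

lemma hyperCoeff_mul {ν : ℂ} (hν : ν.im ≠ 0) {n k : ℕ} (hk : k ≤ n) :
    hyperCoeff ν n k * (k.factorial * (2 * n).descFactorial k * poch (2 * ν + 2 * n) k)
      = n.descFactorial k * 4 ^ k * poch (ν - 1 / 2) k * poch (ν + n) k := by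
  induction k with
  | zero => simp [poch_zero, hyperCoeff_zero]
  | succ k ih =>
    have h := hyperCoeff_succ_mul hν (show k ≤ n by lia)
    have ih := ih (by lia)
    rw [Nat.factorial_succ, Nat.descFactorial_succ, Nat.descFactorial_succ, poch_succ, poch_succ,
      poch_succ]
    push_cast [show k ≤ 2 * n by lia, show k ≤ n by lia]
    linear_combination (k.factorial * (2 * n).descFactorial k * poch (2 * ν + 2 * n) k) * h
      + ((n - k) * (2 * ν + 2 * k - 1) * (2 * ν + 2 * n + 2 * k)) * ih

lemma bdet_ratio_hyperCoeff {ν : ℂ} (hν : ν.im ≠ 0) (n : ℕ) :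
    bdet (2 * ν) (2 * n + 1) 1 0 * ((-1) ^ n * hyperCoeff ν n n * (2 * ν + 2 * n - 1))
      = bdet (2 * ν) (2 * n) 1 0 * (-2 * oddSum ν n n * (2 * n + 1)) := by
  have hμ : (2 * ν).im ≠ 0 := by simpa using hν
  have h := bdet_ratio_of_symmetric hμ (natDegree_hyperPoly ν n) (hyperPoly_comp ν n)
    fun l hl => by rw [coeff_hyperPoly_mul_twistSeries, oddSum_eq_zero hν hl]
  rw [coeff_hyperPoly_mul_twistSeries, coeff_hyperPoly_top] at h
  have hw := weight_ne_zero hμ (2 * n)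
  have hw' := weight_ne_zero hμ (2 * n + 1)
  have hn : (2 * n + 1 : ℂ) ≠ 0 := by exact_mod_cast (2 * n).succ_ne_zero
  have hsucc : weight (2 * ν) (2 * n + 1) * (2 * n + 1)
      = weight (2 * ν) (2 * n) * (2 * ν + 2 * n - 1) := by
    have hf : ((2 * n).factorial : ℂ) ≠ 0 := by exact_mod_cast (2 * n).factorial_ne_zero
    rw [weight, weight, poch_succ, Nat.factorial_succ]
    push_cast
    field_simp
    ring
  rw [mul_div_assoc', mul_div_assoc', div_eq_div_iff hw hw'] at h
  refine mul_right_cancel₀ hw ?_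
  linear_combination (2 * n + 1) * h - bdet (2 * ν) (2 * n + 1) 1 0 * (-1) ^ n
    * hyperCoeff ν n n * hsucc

lemma quotient_Q3_of_im_ne_zero {ν : ℂ} (hν : ν.im ≠ 0) {n : ℕ} (hn : 1 ≤ n) :
    bdet (2 * ν) (2 * n + 1) 1 0 * poch (n + 1) n * poch (ν + n + 1) n
      = 2 * poch (ν + 2 * n) (n + 1) * poch (2 * ν + 2 * n + 1) (n - 1)
        * bdet (2 * ν) (2 * n) 1 0 := by
  have h1 := oddSum_self hν n
  have h2 := hyperCoeff_mul hν (le_refl n)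
  have h3 := bdet_ratio_hyperCoeff hν n
  have h4 : (ν - 1 / 2) * poch (ν + 1 / 2) n = poch (ν - 1 / 2) n * (ν + n - 1 / 2) := by
    have := poch_succ' (ν - 1 / 2) n
    rw [poch_succ, show ν - 1 / 2 + 1 = ν + 1 / 2 by ring] at this
    linear_combination -this
  have h5 : (ν + n) * poch (ν + n + 1) n = poch (ν + n) n * (ν + 2 * n) := by
    have := poch_succ' (ν + n) n
    rw [poch_succ] at this
    linear_combination -this
  have h6 : poch (2 * ν + 2 * n) n = (2 * ν + 2 * n) * poch (2 * ν + 2 * n + 1) (n - 1) := by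
    rw [← poch_succ', Nat.sub_add_cancel hn]
  have h7 : ((2 * n).descFactorial n : ℂ) = poch (n + 1) n := by
    rw [Nat.descFactorial_eq_factorial_mul_choose]
    have := gbinom_add_nat (n + 1) n
    rw [show (n + 1 + n - 1 : ℂ) = (2 * n : ℕ) by push_cast; ring, gbinom_eq_choose,
      Ring.choose_natCast] at this
    push_cast
    linear_combination this
  have h8 : ((2 * n).factorial : ℂ) = n.factorial * poch (n + 1) n := by
    rw [← h7]
    have := Nat.factorial_mul_descFactorial (show n ≤ 2 * n by lia)
    rw [show 2 * n - n = n by lia] at this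
    exact_mod_cast this.symm
  rw [Nat.descFactorial_self, h7] at h2
  rw [h8] at h1
  rw [poch_succ' (ν + 2 * n)]
  have hp : poch (n + 1) n ≠ 0 := by
    rw [← h7]; exact_mod_cast (Nat.descFactorial_pos.2 (by lia)).ne'
  have hq : poch (ν - 1 / 2) n ≠ 0 := poch_ne_zero (by simpa using hν) n
  have hf : (n.factorial : ℂ) ≠ 0 := by exact_mod_cast n.factorial_ne_zero
  have hc : 2 * ν + 2 * n - 1 ≠ 0 := by
    convert linear_ne_zero hν 2 (2 * n - 1) two_ne_zero using 1; push_cast; ring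
  have hd : ν + n ≠ 0 := by simpa using linear_ne_zero hν 1 n one_ne_zero
  have hs : (-1 : ℂ) ^ n * 4 ^ n ≠ 0 := by simp
  have main : bdet (2 * ν) (2 * n + 1) 1 0 * poch (n + 1) n * poch (ν + n) n
      = bdet (2 * ν) (2 * n) 1 0 * poch (ν + 2 * n + 1) n * poch (2 * ν + 2 * n) n := by
    refine mul_right_cancel₀ (mul_ne_zero (mul_ne_zero (mul_ne_zero (mul_ne_zero hs hq) hc) hf)
      hf) ?_
    generalize bdet (2 * ν) (2 * n + 1) 1 0 = b₁ at *
    generalize bdet (2 * ν) (2 * n) 1 0 = b₀ at *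
    generalize poch (ν + 1 / 2) n = p at *
    generalize poch (ν - 1 / 2) n = p' at *
    generalize poch (n + 1) n = a at *
    generalize poch (ν + n) n = v at *
    generalize poch (ν + 2 * n + 1) n = w at *
    generalize poch (2 * ν + 2 * n) n = z at *
    linear_combination
      -(b₁ * a * (-1) ^ n * (2 * ν + 2 * n - 1) * n.factorial) * h2
      + (n.factorial ^ 2 * a ^ 2 * z) * h3 - b₀ * z * h1
      + (2 * b₀ * z * (-1) ^ n * n.factorial ^ 2 * 4 ^ n * w) * h4
  refine mul_right_cancel₀ hd ?_
  rw [h6] at main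
  linear_combination (ν + 2 * n) * main
    + bdet (2 * ν) (2 * n + 1) 1 0 * poch (n + 1) n * h5

lemma continuous_gbinom (k : ℕ) : Continuous fun x => gbinom x k := by
  unfold gbinom
  fun_prop

lemma continuous_poch (k : ℕ) : Continuous fun x => poch x k := by
  unfold poch
  fun_prop

lemma continuous_bdet (n I J : ℕ) : Continuous fun μ => bdet μ n I J := by
  refine Continuous.matrix_det (continuous_matrix fun i j => continuous_const.add ?_)
  exact (continuous_gbinom _).comp (by fun_prop)

/-- The quotient `Q3(n) = b_{2n+1}(1,0)/b_{2n}(1,0)` (cleared form). -/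
theorem quotient_Q3 (μ : ℂ) (n : ℕ) (hn : 1 ≤ n) :
    bdet μ (2 * n + 1) 1 0 * poch ((n : ℂ) + 1) n * poch (μ / 2 + n + 1) n
      = 2 * poch (μ / 2 + 2 * n) (n + 1) * poch (μ + 2 * n + 1) (n - 1)
        * bdet μ (2 * n) 1 0 := by
  have hdense : Dense {z : ℂ | z.im ≠ 0} :=
    (dense_compl_singleton (0 : ℝ)).preimage Complex.isOpenMap_im
  have hpoch (k : ℕ) {f : ℂ → ℂ} (hf : Continuous f) : Continuous fun z => poch (f z) k :=
    (continuous_poch k).comp hf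
  refine congrFun (Continuous.ext_on
    (f := fun z => bdet z (2 * n + 1) 1 0 * poch ((n : ℂ) + 1) n * poch (z / 2 + n + 1) n)
    (g := fun z => 2 * poch (z / 2 + 2 * n) (n + 1) * poch (z + 2 * n + 1) (n - 1)
      * bdet z (2 * n) 1 0) hdense ?_ ?_ fun z hz => ?_) μ
  · exact ((continuous_bdet _ _ _).mul continuous_const).mul (hpoch n (by fun_prop))
  · exact ((continuous_const.mul (hpoch _ (by fun_prop))).mul (hpoch _ (by fun_prop))).mul
      (continuous_bdet _ _ _)
  · have hz' : (z / 2).im ≠ 0 := by simpa using hz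
    simpa only [mul_div_cancel₀ z (two_ne_zero' ℂ)] using quotient_Q3_of_im_ne_zero hz' hn
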